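/- If a group G with finite inverse-closed generating set X has the synchronous falsification by fellow traveler property with constant k, then (G,X) is almost convex; moreover the almost convexity constant C can be taken to be at most 3k. -/

import Mathlib

/-!  Common framework: words over an inverse-closed generating set, word length,
geodesics, falsification by fellow traveler property, almost convexity. -/

namespace ACPaper

variable {β G : Type*} [Group G]

/-- A letter is a generator (`Sum.inl`) or the formal inverse of a generator (`Sum.inr`);
this realizes the inverse-closed alphabet `X^{±1}`. -/
def letterEval (gen : β → G) : β ⊕ β → G :=
  Sum.elim gen fun b => (gen b)⁻¹

/-- Evaluation of a word over `X^{±1}` in the group. -/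
def eval (gen : β → G) (w : List (β ⊕ β)) : G :=
  (w.map (letterEval gen)).prod

/-- `gen` is a generating set: every element is represented by some word. -/
def Generates (gen : β → G) : Prop :=
  ∀ g : G, ∃ w : List (β ⊕ β), eval gen w = g

/-- Word length of a group element with respect to the generating set. -/
noncomputable def wlen (gen : β → G) (g : G) : ℕ :=
  sInf {n : ℕ | ∃ w : List (β ⊕ β), eval gen w = g ∧ w.length = n}

/-- A word is geodesic if its length equals the word length of the element it represents. -/
def IsGeodesic (gen : β → G) (w : List (β ⊕ β)) : Prop :=
  w.length = wlen gen (eval gen w)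

/-- The point reached after `t` steps along the unit-speed path labelled by `w`
(the path remains at its endpoint after time `w.length`). -/
def pos (gen : β → G) (w : List (β ⊕ β)) (t : ℕ) : G :=
  eval gen (w.take t)

/-- Synchronous falsification by fellow traveler property with constant `k`:
every non-geodesic word is synchronously `k`-fellow traveled by a shorter word
representing the same element. -/
def SynchFFTP (gen : β → G) (k : ℕ) : Prop :=
  ∀ w : List (β ⊕ β), ¬ IsGeodesic gen w →
    ∃ w' : List (β ⊕ β), eval gen w' = eval gen w ∧ w'.length < w.length ∧
      ∀ t : ℕ, wlen gen ((pos gen w t)⁻¹ * pos gen w' t) ≤ k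

/-- The path starting at `g` labelled by the word `w` stays in the ball of radius `N`
about the identity. -/
def PathInBall (gen : β → G) (N : ℕ) (g : G) (w : List (β ⊕ β)) : Prop :=
  ∀ t : ℕ, wlen gen (g * pos gen w t) ≤ N

/-- Almost convexity with constant `C`: any two elements of the sphere of radius `N ≥ 1`
at distance at most `2` are joined by a path of length at most `C` inside the ball of
radius `N`. -/
def AlmostConvexWith (gen : β → G) (C : ℕ) : Prop :=
  ∀ N : ℕ, 1 ≤ N → ∀ g g' : G, wlen gen g = N → wlen gen g' = N →
    wlen gen (g⁻¹ * g') ≤ 2 →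
    ∃ w : List (β ⊕ β), g * eval gen w = g' ∧ w.length ≤ C ∧ PathInBall gen N g w

/-- Almost convexity: almost convex with some positive constant. -/
def AlmostConvex (gen : β → G) : Prop :=
  ∃ C : ℕ, 0 < C ∧ AlmostConvexWith gen C


section

variable (gen : β → G)

@[simp] theorem eval_nil : eval gen [] = 1 := rfl

theorem eval_append (u v : List (β ⊕ β)) : eval gen (u ++ v) = eval gen u * eval gen v := by
  simp [eval]

theorem pos_append (u v : List (β ⊕ β)) (t : ℕ) :
    pos gen (u ++ v) t = pos gen u t * pos gen v (t - u.length) := by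
  simp only [pos, List.take_append, eval_append]

theorem pos_mul_eval_drop (w : List (β ⊕ β)) (t : ℕ) :
    pos gen w t * eval gen (w.drop t) = eval gen w := by
  rw [pos, ← eval_append, List.take_append_drop]

theorem pos_of_length_le {w : List (β ⊕ β)} {t : ℕ} (h : w.length ≤ t) :
    pos gen w t = eval gen w := by
  rw [pos, List.take_of_length_le h]

@[simp] theorem pos_zero (w : List (β ⊕ β)) : pos gen w 0 = 1 := by
  simp [pos]

theorem pos_mul_pos_drop (w : List (β ⊕ β)) (s t : ℕ) :
    pos gen w s * pos gen (w.drop s) t = pos gen w (s + t) := by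
  simp only [pos, ← eval_append, List.take_add]

/-- The formal inverse of a word. -/
def invWord (w : List (β ⊕ β)) : List (β ⊕ β) := (w.map Sum.swap).reverse

@[simp] theorem length_invWord (w : List (β ⊕ β)) : (invWord w).length = w.length := by
  simp [invWord]

@[simp] theorem eval_invWord (w : List (β ⊕ β)) : eval gen (invWord w) = (eval gen w)⁻¹ := by
  induction w with
  | nil => simp [invWord]
  | cons a w ih =>
    have h : invWord (a :: w) = invWord w ++ [a.swap] := by simp [invWord]
    rw [h, eval_append, ih]
    cases a <;> simp [eval, letterEval]

theorem eval_mul_pos_invWord (w : List (β ⊕ β)) (t : ℕ) :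
    eval gen w * pos gen (invWord w) t = pos gen w (w.length - t) := by
  have h : (invWord w).take t = invWord (w.drop (w.length - t)) := by
    simp [invWord, List.take_reverse, List.map_drop]
  rw [pos, h, eval_invWord, ← pos_mul_eval_drop gen w (w.length - t)]
  group

theorem wlen_eval_le (w : List (β ⊕ β)) : wlen gen (eval gen w) ≤ w.length :=
  Nat.sInf_le ⟨w, rfl, rfl⟩

theorem wlen_pos_le (w : List (β ⊕ β)) (t : ℕ) : wlen gen (pos gen w t) ≤ t :=
  (wlen_eval_le gen _).trans (List.length_take_le t w)

@[simp] theorem wlen_one : wlen gen 1 = 0 := by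
  simpa using wlen_eval_le gen []

variable {gen}

theorem Generates.exists_geodesic (hgen : Generates gen) (g : G) :
    ∃ w : List (β ⊕ β), eval gen w = g ∧ w.length = wlen gen g := by
  obtain ⟨w, hw⟩ := hgen g
  exact Nat.sInf_mem (s := {n : ℕ | ∃ w : List (β ⊕ β), eval gen w = g ∧ w.length = n})
    ⟨_, w, hw, rfl⟩

theorem Generates.wlen_mul_eval_le (hgen : Generates gen) (g : G) (w : List (β ⊕ β)) :
    wlen gen (g * eval gen w) ≤ wlen gen g + w.length := by
  obtain ⟨u, rfl, hu⟩ := hgen.exists_geodesic g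
  rw [← eval_append, ← hu, ← List.length_append]
  exact wlen_eval_le gen _

theorem PathInBall.append {N : ℕ} {g : G} {u v : List (β ⊕ β)} (hu : PathInBall gen N g u)
    (hv : PathInBall gen N (g * eval gen u) v) : PathInBall gen N g (u ++ v) := by
  intro t
  rw [pos_append]
  rcases le_total t u.length with h | h
  · simpa [Nat.sub_eq_zero_of_le h] using hu t
  · simpa only [pos_of_length_le gen h, mul_assoc] using hv (t - u.length)

theorem PathInBall.invWord {N : ℕ} {g : G} {w : List (β ⊕ β)} (hw : PathInBall gen N g w) :
    PathInBall gen N (g * eval gen w) (invWord w) := by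
  intro t
  rw [mul_assoc, eval_mul_pos_invWord]
  exact hw _

theorem PathInBall.drop {N : ℕ} {w : List (β ⊕ β)} (hw : PathInBall gen N 1 w) (s : ℕ) :
    PathInBall gen N (pos gen w s) (w.drop s) := by
  intro t
  rw [pos_mul_pos_drop]
  simpa using hw (s + t)

/-- A word of length at most `N + 1` whose endpoint lies in the ball of radius `N` stays in
that ball. -/
theorem pathInBall_one {N : ℕ} {w : List (β ⊕ β)} (hlen : w.length ≤ N + 1)
    (hend : wlen gen (eval gen w) ≤ N) : PathInBall gen N 1 w := by
  intro t
  rw [one_mul]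
  rcases le_or_gt t N with h | h
  · exact (wlen_pos_le gen w t).trans h
  · rwa [pos_of_length_le gen (hlen.trans h)]

/-- A path of length at most `k` joining two points of the ball of radius `r` stays in the ball
of radius `r + k / 2`. -/
theorem Generates.pathInBall_add_half (hgen : Generates gen) {r k : ℕ} {g : G}
    {w : List (β ⊕ β)} (hstart : wlen gen g ≤ r) (hend : wlen gen (g * eval gen w) ≤ r)
    (hlen : w.length ≤ k) : PathInBall gen (r + k / 2) g w := by
  intro t
  have h₁ : wlen gen (g * pos gen w t) ≤ wlen gen g + (w.take t).length :=
    hgen.wlen_mul_eval_le g (w.take t)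
  have h₂ := hgen.wlen_mul_eval_le (g * eval gen w) (ACPaper.invWord (w.drop t))
  rw [eval_invWord, ← pos_mul_eval_drop gen w t, ← mul_assoc, mul_inv_cancel_right, mul_assoc,
    pos_mul_eval_drop, length_invWord, List.length_drop] at h₂
  rw [List.length_take] at h₁
  omega

end

/-- If a group `G` with finite inverse-closed generating set `X` has the
synchronous falsification by fellow traveler property with constant `k`, then `(G,X)` is
almost convex, with almost convexity constant at most `3k`. -/
theorem fftp_implies_almostConvex {β G : Type*} [Group G] [Fintype β]
    (gen : β → G) (hgen : Generates gen)
    (k : ℕ) (hk : 0 < k) (hfftp : SynchFFTP gen k) :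
    ∃ C : ℕ, 0 < C ∧ C ≤ 3 * k ∧ AlmostConvexWith gen C := by
  refine ⟨3 * k, by omega, le_rfl, fun N _ g g' hg hg' hd => ?_⟩
  obtain ⟨z, hz, hzlen⟩ := hgen.exists_geodesic (g⁻¹ * g')
  obtain ⟨u, hu, hulen⟩ := hgen.exists_geodesic g
  rcases Nat.eq_zero_or_pos z.length with hz0 | hz0
  · obtain rfl := List.length_eq_zero_iff.mp hz0
    refine ⟨[], ?_, by simp, fun t => by simp [pos, hg]⟩
    rw [hz, mul_inv_cancel_left]
  have huz : eval gen (u ++ z) = g' := by rw [eval_append, hu, hz, mul_inv_cancel_left]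
  obtain ⟨v, hv, hvlen, hfellow⟩ := hfftp (u ++ z) (by
    rw [IsGeodesic, huz, List.length_append]
    omega)
  rw [huz] at hv
  rw [List.length_append] at hvlen
  have huN : PathInBall gen N 1 u := pathInBall_one (by omega) (by rw [hu, hg])
  have hvN : PathInBall gen N 1 v := pathInBall_one (by omega) (by rw [hv, hg'])
  set t := N - k / 2 with ht
  have hut : pos gen (u ++ z) t = pos gen u t := by
    rw [pos_append, Nat.sub_eq_zero_of_le (by omega : t ≤ u.length), pos_zero, mul_one]
  obtain ⟨j, hj, hjlen⟩ := hgen.exists_geodesic ((pos gen u t)⁻¹ * pos gen v t)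
  have hjk : j.length ≤ k := by
    rw [hjlen, ← hut]
    exact hfellow t
  have hjend : pos gen u t * eval gen j = pos gen v t := by rw [hj, mul_inv_cancel_left]
  have hjN : PathInBall gen N (pos gen u t) j := by
    rcases le_total (k / 2) N with h | h
    · rw [← Nat.sub_add_cancel h]
      exact hgen.pathInBall_add_half (wlen_pos_le gen u t)
        (hjend ▸ wlen_pos_le gen v t) hjk
    · have ht0 : t = 0 := Nat.sub_eq_zero_of_le h
      have hj0 : j = [] := by simpa [ht0] using hjlen
      intro s
      simp [hj0, ht0, pos]
  have hback : g * eval gen (invWord (u.drop t)) = pos gen u t := by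
    rw [eval_invWord, ← hu, ← pos_mul_eval_drop gen u t, mul_inv_cancel_right]
  have hbackN : PathInBall gen N g (invWord (u.drop t)) := by
    have h := (huN.drop t).invWord
    rwa [pos_mul_eval_drop, hu] at h
  refine ⟨invWord (u.drop t) ++ (j ++ v.drop t), ?_, ?_,
    hbackN.append (hback ▸ hjN.append (hjend ▸ hvN.drop t))⟩
  · rw [eval_append, eval_append, ← mul_assoc, hback, ← mul_assoc, hjend, pos_mul_eval_drop, hv]
  · simp only [List.length_append, length_invWord, List.length_drop]
    omega

end ACPaper
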